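/- arXiv:2012.13284 — 2 statements merged into one kernel-verified Lean document; each statement's English description precedes it below -/
import Mathlib

section
/- Let K_1, …, K_n ⊆ ℂ be pairwise disjoint compact sets, each with connected complement ℂ \ K_j. For each k, let L_k ⊆ K_k be a finite set and let f_k be holomorphic on an open neighborhood of K_k. Then for every ε > 0 there exists an entire function f such that for every k: (1) sup_{z ∈ K_k} |f(z) − f_k(z)| < ε; (2) f(x) = f_k(x) for all x ∈ L_k; and (3) f'(x) = f_k'(x) for all x ∈ L_k. -/
open Set Filter Topology MeasureTheory

/-- `z - a` has a continuous logarithm on `K`. -/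
def HasLogOn (K : Set ℂ) (a : ℂ) : Prop :=
  ∃ g : ℂ → ℂ, ContinuousOn g K ∧ ∀ z ∈ K, Complex.exp (g z) = z - a

lemma hasLogOn_of_near {K : Set ℂ} {a b : ℂ} (h : HasLogOn K a)
    (hab : ∀ z ∈ K, ‖b - a‖ < ‖z - a‖) : HasLogOn K b := by
  obtain ⟨g, hg, hg'⟩ := h
  have hne : ∀ z ∈ K, z - a ≠ 0 := fun z hz h0 => by
    have := hab z hz
    rw [h0, norm_zero] at this
    exact absurd this (not_lt.2 (norm_nonneg _))
  have hsl : ∀ z ∈ K, 1 - (b - a) / (z - a) ∈ Complex.slitPlane := fun z hz => by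
    have := Complex.mem_slitPlane_of_norm_lt_one (z := - ((b - a) / (z - a))) (by
      rw [norm_neg, norm_div, div_lt_one (norm_pos_iff.2 (hne z hz))]; exact hab z hz)
    simpa [sub_eq_add_neg] using this
  refine ⟨fun z => g z + Complex.log (1 - (b - a) / (z - a)), ?_, ?_⟩
  · refine hg.add (ContinuousOn.clog ?_ hsl)
    exact continuousOn_const.sub (continuousOn_const.div (by fun_prop) hne)
  · intro z hz
    rw [Complex.exp_add, hg' z hz, Complex.exp_log (Complex.slitPlane_ne_zero (hsl z hz))]
    have := hne z hz
    field_simp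
    ring

lemma hasLogOn_of_compl {K : Set ℂ} (hK : IsCompact K) (hc : IsPreconnected Kᶜ) {a : ℂ}
    (ha : a ∉ K) : HasLogOn K a := by
  obtain ⟨R, hR⟩ := hK.isBounded.exists_norm_le
  set b : ℂ := -((|R| + 1 : ℝ) : ℂ) with hb
  have hre : ∀ z ∈ K, 0 < (z - b).re := fun z hz => by
    have h1 := hR z hz
    have h2 := Complex.abs_re_le_norm z
    have h3 := neg_abs_le z.re
    have h4 := le_abs_self R
    rw [hb]
    simp only [sub_neg_eq_add, Complex.add_re, Complex.ofReal_re]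
    linarith
  have hbK : b ∉ K := fun h => by simpa using hre b h
  have hlog : HasLogOn K b := by
    refine ⟨fun z => Complex.log (z - b), ContinuousOn.clog (by fun_prop)
      (fun z hz => Or.inl (hre z hz)), fun z hz => Complex.exp_log fun h => ?_⟩
    have := hre z hz
    rw [h] at this
    simp at this
  refine (hc.induction₂ (fun x y => HasLogOn K x ↔ HasLogOn K y) ?_ ?_ ?_ hbK ha).1 hlog
  · intro x hx
    obtain ⟨d, hd, hball⟩ := Metric.isOpen_iff.1 hK.isClosed.isOpen_compl x hx
    have hd' : ∀ z ∈ K, d ≤ ‖z - x‖ := fun z hz => by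
      by_contra! h
      exact hball (by simpa [dist_eq_norm] using h) hz
    refine mem_nhdsWithin_of_mem_nhds ?_
    filter_upwards [Metric.ball_mem_nhds x (half_pos hd)] with y hy
    rw [Metric.mem_ball, dist_eq_norm] at hy
    constructor
    · intro h
      exact hasLogOn_of_near h fun z hz => by linarith [hd' z hz]
    · intro h
      refine hasLogOn_of_near h fun z hz => ?_
      have h1 : ‖z - x‖ ≤ ‖z - y‖ + ‖y - x‖ := by
        simpa using norm_add_le (z - y) (y - x)
      rw [norm_sub_rev]
      linarith [hd' z hz]
  · intro x y z _ _ _ h1 h2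
    exact h1.trans h2
  · intro x y _ _ h
    exact h.symm

lemma hasLogOn_iUnion {n : ℕ} {K : Fin n → Set ℂ} (hK : ∀ k, IsCompact (K k))
    (hdisj : Pairwise (Function.onFun Disjoint K)) {a : ℂ} (h : ∀ k, HasLogOn (K k) a) :
    HasLogOn (⋃ k, K k) a := by
  classical
  choose g hg hg' using h
  let G : ℂ → ℂ := fun z => if hz : ∃ k, z ∈ K k then g hz.choose z else 0
  have hG : ∀ k, ∀ z ∈ K k, G z = g k z := fun k z hz => by
    have hex : ∃ k, z ∈ K k := ⟨k, hz⟩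
    have : hex.choose = k := by
      by_contra hne
      exact Set.disjoint_left.1 (hdisj hne) hex.choose_spec hz
    simp only [G, dif_pos hex, this]
  refine ⟨G, (locallyFinite_of_finite K).continuousOn_iUnion (fun k => (hK k).isClosed)
    (fun k => (hg k).congr (hG k)), ?_⟩
  intro z hz
  obtain ⟨k, hk⟩ := mem_iUnion.1 hz
  rw [hG k z hk, hg' k z hk]

lemma no_log_circle (a : ℂ) (R : ℝ) (hR : 0 < R) (ψ : ℂ → ℂ) (hψ : Continuous ψ)
    (h : ∀ z, ‖z - a‖ = R → Complex.exp (ψ z) = z - a) : False := by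
  let q : ℝ → ℂ := fun t => ψ (a + R * Complex.exp (t * Complex.I)) - t * Complex.I
  have hq : Continuous q := by fun_prop
  have hexp : ∀ t, Complex.exp (q t) = R := fun t => by
    simp only [q, Complex.exp_sub]
    rw [h _ (by simp [Complex.norm_exp_ofReal_mul_I, abs_of_pos hR])]
    field_simp [Complex.exp_ne_zero]
    ring
  have hconst : ∀ t, q t = q 0 := by
    intro t
    have hcov := Complex.isCoveringMap_exp
    have := hcov.eq_of_comp_eq hq (continuous_const (y := q 0)) (by
      ext t; simp [hexp]) (0 : ℝ) rfl
    exact congrFun this t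
  have h2 := hconst (2 * Real.pi)
  simp [q, Complex.exp_two_pi_mul_I] at h2

lemma no_bounded_component {K V : Set ℂ} {a : ℂ} (hK : IsCompact K) (hV : IsOpen V)
    (hVb : Bornology.IsBounded V) (hfr : frontier V ⊆ K) (ha : a ∈ V)
    (hlog : HasLogOn K a) : False := by
  classical
  obtain ⟨g, hg, hg'⟩ := hlog
  obtain ⟨G, hG⟩ := ContinuousMap.exists_restrict_eq hK.isClosed
    (⟨K.domRestrict g, continuousOn_iff_continuous_domRestrict.mp hg⟩ : C(K, ℂ))
  have hG' : ∀ z ∈ K, G z = g z := fun z hz => congrArg (fun F : C(K, ℂ) => F ⟨z, hz⟩) hG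
  let φ : ℂ → ℂ := fun z => if z ∈ V then Complex.exp (G z) else z - a
  have hφ : Continuous φ := by
    refine continuous_if ?_ ?_ ?_
    · intro z hz
      have hz' : z ∈ K := hfr hz
      rw [hG' z hz', hg' z hz']
    · exact (Complex.continuous_exp.comp G.continuous).continuousOn
    · fun_prop
  have hφ0 : ∀ z, φ z ≠ 0 := fun z => by
    by_cases hz : z ∈ V
    · simp [φ, hz]
    · simp only [φ, hz, if_false]
      intro h0
      exact hz (by rwa [sub_eq_zero.1 h0])
  obtain ⟨ψ, hψ, hψ'⟩ := Complex.exists_continuousOn_eqOn_exp_comp (U := (univ : Set ℂ))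
    (by
      have := (convex_univ : Convex ℝ (univ : Set ℂ)).contractibleSpace univ_nonempty
      exact (inferInstance : SimplyConnectedSpace (univ : Set ℂ))) isOpen_univ hφ.continuousOn (by simpa using hφ0)
  obtain ⟨R, hR, hVR⟩ := hVb.subset_ball_lt 0 a
  refine no_log_circle a R hR ψ (continuousOn_univ.1 hψ) fun z hz => ?_
  have hzV : z ∉ V := fun h => by
    have := hVR h
    rw [Metric.mem_ball, dist_eq_norm] at this
    linarith
  have := hψ' (mem_univ z)
  simpa [φ, hzV] using this

lemma frontier_component {K : Set ℂ} (hK : IsClosed K) (a : ℂ) :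
    frontier (connectedComponentIn Kᶜ a) ⊆ K := by
  intro z hz
  by_contra hzK
  have hopen : IsOpen (connectedComponentIn Kᶜ a) := hK.isOpen_compl.connectedComponentIn
  rw [hopen.frontier_eq] at hz
  have hzopen : IsOpen (connectedComponentIn Kᶜ z) := hK.isOpen_compl.connectedComponentIn
  have hzmem : z ∈ connectedComponentIn Kᶜ z := mem_connectedComponentIn hzK
  obtain ⟨y, hy1, hy2⟩ := mem_closure_iff.1 hz.1 _ hzopen hzmem
  refine hz.2 ?_
  rw [connectedComponentIn_eq hy2, ← connectedComponentIn_eq hy1]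
  exact hzmem

lemma exists_inv_mem {K : Set ℂ} (hK : IsCompact K) [CompactSpace K]
    (hlog : ∀ a ∉ K, HasLogOn K a)
    (a : ℂ) (ha : a ∉ K) : ∃ F ∈ (polynomialFunctions K).topologicalClosure,
      ∀ z : K, F z = ((z : ℂ) - a)⁻¹ := by
  set S := (polynomialFunctions K).topologicalClosure with hS
  have hcl : IsClosed (S : Set C(K, ℂ)) := Subalgebra.isClosed_topologicalClosure _
  let x : S := ⟨Polynomial.toContinuousMapOn Polynomial.X K,
    Subalgebra.le_topologicalClosure _ ⟨Polynomial.X, by simp, rfl⟩⟩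
  have hspec : spectrum ℂ (x : C(K, ℂ)) = K := by
    rw [ContinuousMap.spectrum_eq_range]
    ext z
    simp [x]
  have hnot : a ∉ spectrum ℂ x := by
    intro hmem
    have hb := Subalgebra.spectrum_isBounded_connectedComponentIn (hS := hcl) S x hmem
    rw [hspec] at hb
    exact no_bounded_component hK hK.isClosed.isOpen_compl.connectedComponentIn hb
      (frontier_component hK.isClosed a) (mem_connectedComponentIn ha) (hlog a ha)
  rw [spectrum.notMem_iff] at hnot
  obtain ⟨u, hu⟩ := hnot
  refine ⟨((-(u⁻¹ : Sˣ) : S) : C(K, ℂ)), (-((u⁻¹ : Sˣ) : S)).2, fun z => ?_⟩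
  have h1 : (u : S) * ((u⁻¹ : Sˣ) : S) = 1 := u.mul_inv
  rw [hu] at h1
  have h2 := congrArg (fun y : S => (y : C(K, ℂ)) z) h1
  simp [x] at h2
  have hne : (z : ℂ) - a ≠ 0 := fun h => ha (by rw [← sub_eq_zero.1 h]; exact z.2)
  refine eq_inv_of_mul_eq_one_left ?_
  have h3 : ((algebraMap ℂ S a : S) : C(K, ℂ)) z = a := rfl
  simp
  linear_combination h2

lemma square_boundary (z : ℂ) (A : ℝ) (hA : 0 < A) :
    (∫ x : ℝ in (z.re - A)..(z.re + A), (((x + (z.im - A : ℝ) * Complex.I : ℂ)) - z)⁻¹)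
    - (∫ x : ℝ in (z.re - A)..(z.re + A), (((x + (z.im + A : ℝ) * Complex.I : ℂ)) - z)⁻¹)
    + Complex.I * (∫ y : ℝ in (z.im - A)..(z.im + A), ((((z.re + A : ℝ) + y * Complex.I : ℂ)) - z)⁻¹)
    - Complex.I * (∫ y : ℝ in (z.im - A)..(z.im + A), ((((z.re - A : ℝ) + y * Complex.I : ℂ)) - z)⁻¹)
    = 4 * A * Complex.I * ((∫ t : ℝ in (-A)..A, (t ^ 2 + A ^ 2)⁻¹ : ℝ) : ℂ) := by
  have hz : z = z.re + z.im * Complex.I := (Complex.re_add_im z).symm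
  have hx : ∀ (B : ℝ) , (∫ x : ℝ in (z.re - A)..(z.re + A),
      (((x + (z.im + B : ℝ) * Complex.I : ℂ)) - z)⁻¹) =
      ∫ t : ℝ in (-A)..A, ((t + B * Complex.I : ℂ))⁻¹ := by
    intro B
    have := intervalIntegral.integral_comp_add_right (a := -A) (b := A)
      (fun x : ℝ => (((x + (z.im + B : ℝ) * Complex.I : ℂ)) - z)⁻¹) z.re
    rw [show -A + z.re = z.re - A by ring, show A + z.re = z.re + A by ring] at this
    rw [← this]
    congr 1
    ext t
    congr 1
    nth_rw 3 [hz]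
    push_cast
    ring
  have hy : ∀ (B : ℝ) , (∫ y : ℝ in (z.im - A)..(z.im + A),
      ((((z.re + B : ℝ) + y * Complex.I : ℂ)) - z)⁻¹) =
      ∫ t : ℝ in (-A)..A, ((B + t * Complex.I : ℂ))⁻¹ := by
    intro B
    have := intervalIntegral.integral_comp_add_right (a := -A) (b := A)
      (fun y : ℝ => ((((z.re + B : ℝ) + y * Complex.I : ℂ)) - z)⁻¹) z.im
    rw [show -A + z.im = z.im - A by ring, show A + z.im = z.im + A by ring] at this
    rw [← this]
    congr 1
    ext t
    congr 1
    nth_rw 3 [hz]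
    push_cast
    ring
  have h1 := hx A
  have h2 := hx (-A)
  have h3 := hy A
  have h4 := hy (-A)
  rw [← sub_eq_add_neg] at h2 h4
  rw [h1, h2, h3, h4]
  have hne1 : ∀ B : ℝ, B ≠ 0 → ∀ t : ℝ, (t + B * Complex.I : ℂ) ≠ 0 := fun B hB t h => by
    have := congrArg Complex.im h
    simp at this
    exact hB this
  have hne2 : ∀ B : ℝ, B ≠ 0 → ∀ t : ℝ, (B + t * Complex.I : ℂ) ≠ 0 := fun B hB t h => by
    have := congrArg Complex.re h
    simp at this
    exact hB this
  have i1 : ∀ B : ℝ, B ≠ 0 → IntervalIntegrable (fun t : ℝ => ((t + B * Complex.I : ℂ))⁻¹)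
      volume (-A) A := fun B hB =>
    (Continuous.inv₀ (by fun_prop) (hne1 B hB)).intervalIntegrable _ _
  have i2 : ∀ B : ℝ, B ≠ 0 → IntervalIntegrable (fun t : ℝ => ((B + t * Complex.I : ℂ))⁻¹)
      volume (-A) A := fun B hB =>
    (Continuous.inv₀ (by fun_prop) (hne2 B hB)).intervalIntegrable _ _
  have hA0 : A ≠ 0 := hA.ne'
  have hA1 : -A ≠ 0 := neg_ne_zero.2 hA0
  rw [← intervalIntegral.integral_sub (i1 _ hA1) (i1 _ hA0), add_sub_assoc, ← mul_sub,
    ← intervalIntegral.integral_sub (i2 _ hA0) (i2 _ hA1), ← intervalIntegral.integral_const_mul,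
    ← intervalIntegral.integral_add ((i1 _ hA1).sub (i1 _ hA0))
      (((i2 _ hA0).sub (i2 _ hA1)).const_mul _), ← intervalIntegral.integral_ofReal,
    ← intervalIntegral.integral_const_mul]
  congr 1
  ext t
  have e1 := hne1 A hA0 t
  have e2 := hne1 (-A) hA1 t
  have e3 := hne2 A hA0 t
  have e4 := hne2 (-A) hA1 t
  have e5 : ((t : ℂ) ^ 2 + (A : ℂ) ^ 2) ≠ 0 := by
    have : (0 : ℝ) < t ^ 2 + A ^ 2 := by positivity
    exact_mod_cast this.ne'
  push_cast at e2 e4 ⊢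
  have f1 : ((t : ℂ) + -A * Complex.I)⁻¹ = (t + A * Complex.I) * ((t : ℂ) ^ 2 + (A : ℂ) ^ 2)⁻¹ := by
    rw [← div_eq_mul_inv, eq_div_iff e5, inv_mul_eq_iff_eq_mul₀ e2]
    linear_combination (A : ℂ) ^ 2 * Complex.I_sq
  have f2 : ((t : ℂ) + A * Complex.I)⁻¹ = (t - A * Complex.I) * ((t : ℂ) ^ 2 + (A : ℂ) ^ 2)⁻¹ := by
    rw [← div_eq_mul_inv, eq_div_iff e5, inv_mul_eq_iff_eq_mul₀ e1]
    linear_combination (A : ℂ) ^ 2 * Complex.I_sq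
  have f3 : ((A : ℂ) + t * Complex.I)⁻¹ = (A - t * Complex.I) * ((t : ℂ) ^ 2 + (A : ℂ) ^ 2)⁻¹ := by
    rw [← div_eq_mul_inv, eq_div_iff e5, inv_mul_eq_iff_eq_mul₀ e3]
    linear_combination (t : ℂ) ^ 2 * Complex.I_sq
  have f4 : (-(A : ℂ) + t * Complex.I)⁻¹ = (-A - t * Complex.I) * ((t : ℂ) ^ 2 + (A : ℂ) ^ 2)⁻¹ := by
    rw [← div_eq_mul_inv, eq_div_iff e5, inv_mul_eq_iff_eq_mul₀ e4]
    linear_combination (t : ℂ) ^ 2 * Complex.I_sq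
  rw [f1, f2, f3, f4]
  ring

lemma square_const_ne_zero (A : ℝ) (hA : 0 < A) :
    4 * A * Complex.I * ((∫ t : ℝ in (-A)..A, (t ^ 2 + A ^ 2)⁻¹ : ℝ) : ℂ) ≠ 0 := by
  have : 0 < ∫ t : ℝ in (-A)..A, (t ^ 2 + A ^ 2)⁻¹ := by
    have hp : ∀ t : ℝ, 0 < t ^ 2 + A ^ 2 := fun t => by positivity
    refine intervalIntegral.intervalIntegral_pos_of_pos ?_ (fun t => inv_pos.2 (hp t)) (by linarith)
    exact (Continuous.inv₀ (by fun_prop) (fun t => (hp t).ne')).intervalIntegrable _ _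
  have h2 : ((∫ t : ℝ in (-A)..A, (t ^ 2 + A ^ 2)⁻¹ : ℝ) : ℂ) ≠ 0 := by exact_mod_cast this.ne'
  have h3 : (A : ℂ) ≠ 0 := by exact_mod_cast hA.ne'
  simp [h2, h3]

/-- The Cauchy-Pompeiu formula on a square. -/
lemma pompeiu (u : ℂ → ℂ) (u' : ℂ → ℂ →L[ℝ] ℂ) (hu : ∀ w, HasFDerivAt u (u' w) w)
    (z : ℂ) (huz : DifferentiableAt ℂ u z) (A : ℝ) (hA : 0 < A)
    (hout : ∀ w, A ≤ ‖w - z‖ → u w = 0)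
    (D : ℂ → ℂ) (hD : Continuous D) (hDu : ∀ w, w ≠ z →
      Complex.I * u' w 1 - u' w Complex.I = D w * (w - z)) :
    (∫ x : ℝ in (z.re - A)..(z.re + A), ∫ y : ℝ in (z.im - A)..(z.im + A), D (x + y * Complex.I))
    = - (4 * A * Complex.I * ((∫ t : ℝ in (-A)..A, (t ^ 2 + A ^ 2)⁻¹ : ℝ) : ℂ)) * u z := by
  let F := dslope u z
  let F' : ℂ → ℂ →L[ℝ] ℂ := fun w => if w = z then 0 else
    (w - z)⁻¹ • u' w + (u w - u z) •
      ((ContinuousLinearMap.toSpanSingleton ℂ (-((w - z) ^ 2)⁻¹)).restrictScalars ℝ)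
  have hFeq : ∀ w, w ≠ z → F w = (w - z)⁻¹ * (u w - u z) := fun w hw => by
    simp [F, dslope_of_ne _ hw, slope_def_field, div_eq_inv_mul]
  have hder : ∀ w, w ≠ z → HasFDerivAt F (F' w) w := by
    intro w hw
    have h1 : HasDerivAt (fun w : ℂ => (w - z)⁻¹) (-((w - z) ^ 2)⁻¹) w := by
      have := ((hasDerivAt_id w).sub_const z).fun_inv (sub_ne_zero.2 hw)
      simpa [neg_div] using this
    have h2 := (h1.hasFDerivAt.restrictScalars ℝ).mul ((hu w).sub_const (u z))
    simp only [F', if_neg hw]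
    refine h2.congr_of_eventuallyEq ?_
    filter_upwards [isOpen_ne.mem_nhds hw] with y hy
    exact hFeq y hy
  have hval : ∀ w, w ≠ z → Complex.I • F' w 1 - F' w Complex.I = D w := by
    intro w hw
    have hwz := sub_ne_zero.2 hw
    simp only [F', if_neg hw]
    simp
    have := hDu w hw
    field_simp
    linear_combination (w - z) * this
  have hcont : Continuous F := by
    rw [continuous_iff_continuousAt]
    intro w
    by_cases hw : w = z
    · rw [hw]; exact continuousAt_dslope_same.2 huz
    · exact (hder w hw).continuousAt
  have hae : (fun w => Complex.I • F' w 1 - F' w Complex.I) =ᵐ[volume] D := by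
    filter_upwards [compl_mem_ae_iff.2 (measure_singleton (μ := (volume : Measure ℂ)) z)] with w hw
    exact hval w hw
  have hgreen := Complex.integral_boundary_rect_of_hasFDerivAt_real_off_countable F F'
    (⟨z.re - A, z.im - A⟩) (⟨z.re + A, z.im + A⟩) {z} (countable_singleton z)
    hcont.continuousOn (fun w hw => hder w hw.2) (by
      refine IntegrableOn.congr_fun_ae (f := D) ?_ (ae_restrict_of_ae hae.symm)
      exact hD.continuousOn.integrableOn_compact (isCompact_uIcc.reProdIm isCompact_uIcc))
  simp only at hgreen
  have hR : (∫ x : ℝ in (z.re - A)..(z.re + A), ∫ y : ℝ in (z.im - A)..(z.im + A),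
      Complex.I • F' (x + y * Complex.I) 1 - F' (x + y * Complex.I) Complex.I) =
      ∫ x : ℝ in (z.re - A)..(z.re + A), ∫ y : ℝ in (z.im - A)..(z.im + A),
        D (x + y * Complex.I) := by
    refine intervalIntegral.integral_congr_ae ?_
    refine ae_of_all _ fun x _ => ?_
    refine intervalIntegral.integral_congr_ae ?_
    filter_upwards [compl_mem_ae_iff.2 (measure_singleton (μ := (volume : Measure ℝ)) z.im)]
      with y hy _
    refine hval _ fun h => hy ?_
    have := congrArg Complex.im h
    simpa using this
  rw [hR] at hgreen
  rw [← hgreen, ← square_boundary z A hA]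
  have hbd : ∀ w, A ≤ ‖w - z‖ → F w = - u z * (w - z)⁻¹ := by
    intro w hw
    have hne : w ≠ z := by
      rintro rfl
      simp at hw
      linarith
    rw [hFeq w hne, hout w hw]
    ring
  have b1 : ∀ (B : ℝ), |B| = A → ∀ x : ℝ, F (x + (z.im + B : ℝ) * Complex.I) =
      - u z * ((x + (z.im + B : ℝ) * Complex.I : ℂ) - z)⁻¹ := fun B hB x => by
    apply hbd
    refine le_trans ?_ (Complex.abs_im_le_norm _)
    simp [hB]
  have b2 : ∀ (B : ℝ), |B| = A → ∀ y : ℝ, F ((z.re + B : ℝ) + y * Complex.I) =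
      - u z * (((z.re + B : ℝ) + y * Complex.I : ℂ) - z)⁻¹ := fun B hB x => by
    apply hbd
    refine le_trans ?_ (Complex.abs_re_le_norm _)
    simp [hB]
  have c1 := b1 A (abs_of_pos hA)
  have c2 := b1 (-A) (by rw [abs_neg, abs_of_pos hA])
  have c3 := b2 A (abs_of_pos hA)
  have c4 := b2 (-A) (by rw [abs_neg, abs_of_pos hA])
  rw [← sub_eq_add_neg] at c2 c4
  simp only [c1, c2, c3, c4, intervalIntegral.integral_const_mul, smul_eq_mul]
  ring

lemma exists_cutoff {K U : Set ℂ} (hK : IsCompact K) (hU : IsOpen U) (hKU : K ⊆ U) :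
    ∃ (χ : ℂ → ℝ) (t : Set ℂ), ContDiff ℝ 1 χ ∧ IsCompact t ∧ t ⊆ U ∧ K ⊆ t ∧
      (∀ z ∈ K, ∀ᶠ w in 𝓝 z, χ w = 1) ∧ ∀ w ∉ t, χ w = 0 := by
  obtain ⟨t, ht, hKt, htU⟩ := exists_compact_between hK hU hKU
  obtain ⟨χ, h1, h0, -⟩ := exists_contMDiffMap_one_nhds_of_subset_interior (n := 1)
    (modelWithCornersSelf ℝ ℂ) hK.isClosed hKt
  refine ⟨χ, t, χ.contMDiff.contDiff, ht, htU, hKt.trans interior_subset, ?_, h0⟩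
  intro z hz
  exact h1.filter_mono (nhds_le_nhdsSet hz)

lemma runge_base {K U : Set ℂ} (hK : IsCompact K) (hlog : ∀ a ∉ K, HasLogOn K a)
    (hU : IsOpen U) (hKU : K ⊆ U) {h : ℂ → ℂ} (hh : DifferentiableOn ℂ h U)
    {ε : ℝ} (hε : 0 < ε) :
    ∃ p : Polynomial ℂ, ∀ z ∈ K, ‖p.eval z - h z‖ < ε := by
  classical
  have : CompactSpace K := isCompact_iff_compactSpace.1 hK
  obtain ⟨χ, t, hχ, ht, htU, hKt, hχ1, hχ0⟩ := exists_cutoff hK hU hKU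
  have hχd : ∀ w, HasFDerivAt χ (fderiv ℝ χ w) w := fun w =>
    ((hχ.differentiable one_ne_zero) w).hasFDerivAt
  have hcd : Continuous (fderiv ℝ χ) := hχ.continuous_fderiv one_ne_zero
  -- the d-bar derivative of the cutoff
  let E : ℂ → ℂ := fun w => Complex.I * (fderiv ℝ χ w 1 : ℂ) - (fderiv ℝ χ w Complex.I : ℂ)
  have hE : Continuous E := by fun_prop
  have hEK : ∀ z ∈ K, ∀ᶠ w in 𝓝 z, E w = 0 := fun z hz => by
    filter_upwards [(hχ1 z hz).eventually_nhds] with w hw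
    have : fderiv ℝ χ w = 0 := by
      have h1 : χ =ᶠ[𝓝 w] fun _ => 1 := hw
      rw [h1.fderiv_eq]; simp
    simp [E, this]
  have htc : ∀ w ∉ t, ∀ᶠ y in 𝓝 w, y ∉ t := fun w hw => ht.isClosed.isOpen_compl.mem_nhds hw
  have hEt : ∀ w ∉ t, E w = 0 := fun w hw => by
    have h1 : χ =ᶠ[𝓝 w] fun _ => 0 := by
      filter_upwards [htc w hw] with y hy using hχ0 y hy
    have : fderiv ℝ χ w = 0 := by rw [h1.fderiv_eq]; simp
    simp [E, this]
  let u : ℂ → ℂ := fun w => (χ w : ℂ) * h w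
  let u' : ℂ → ℂ →L[ℝ] ℂ := fun w => fderiv ℝ u w
  have hu_out : ∀ w ∉ t, u =ᶠ[𝓝 w] fun _ => 0 := fun w hw => by
    filter_upwards [htc w hw] with y hy
    simp [u, hχ0 y hy]
  have hu_in : ∀ w ∈ U, HasFDerivAt u ((χ w : ℂ) • ((fderiv ℂ h w).restrictScalars ℝ)
      + h w • (Complex.ofRealCLM.comp (fderiv ℝ χ w))) w := fun w hw => by
    have h1 : HasFDerivAt h (fderiv ℂ h w) w :=
      (hh.differentiableAt (hU.mem_nhds hw)).hasFDerivAt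
    have h2 : HasFDerivAt (fun w => (χ w : ℂ)) (Complex.ofRealCLM.comp (fderiv ℝ χ w)) w :=
      Complex.ofRealCLM.hasFDerivAt.comp w (hχd w)
    exact h2.mul (h1.restrictScalars ℝ)
  have hu : ∀ w, HasFDerivAt u (u' w) w := fun w => by
    refine DifferentiableAt.hasFDerivAt ?_
    by_cases hw : w ∈ t
    · exact (hu_in w (htU hw)).differentiableAt
    · exact (differentiableAt_const (0 : ℂ)).congr_of_eventuallyEq (hu_out w hw)
  have hdbar : ∀ w, Complex.I * u' w 1 - u' w Complex.I = h w * E w := fun w => by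
    by_cases hw : w ∈ t
    · have h1 := (hu_in w (htU hw)).fderiv
      have h2 : fderiv ℂ h w Complex.I = Complex.I * fderiv ℂ h w 1 := by
        have := (fderiv ℂ h w).map_smul Complex.I 1
        simpa using this
      simp only [u', h1, E]
      simp [h2]
      ring
    · have : u' w = 0 := by
        simp only [u']
        rw [(hu_out w hw).fderiv_eq]; simp
      simp [this, hEt w hw]
  -- the kernel
  let S := (polynomialFunctions K).topologicalClosure
  have hcl : IsClosed (S : Set C(K, ℂ)) := Subalgebra.isClosed_topologicalClosure _
  have : CompleteSpace S := hcl.completeSpace_coe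
  have hΨex : ∀ w, ∃ F : S, ∀ z : K, (F : C(K, ℂ)) z = h w * E w * (w - z)⁻¹ := fun w => by
    by_cases hw : w ∈ K
    · exact ⟨0, fun z => by simp [(hEK w hw).self_of_nhds]⟩
    · obtain ⟨F, hF, hF'⟩ := exists_inv_mem hK hlog w hw
      refine ⟨(-(h w * E w)) • ⟨F, hF⟩, fun z => ?_⟩
      have : (((-(h w * E w)) • (⟨F, hF⟩ : S) : S) : C(K, ℂ)) z = -(h w * E w) * F z := rfl
      rw [this, hF', ← neg_sub w, inv_neg]
      ring
  choose Ψ hΨ using hΨex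
  have hker : Continuous fun p : ℂ × K => h p.1 * E p.1 * (p.1 - (p.2 : ℂ))⁻¹ := by
    rw [continuous_iff_continuousAt]
    rintro ⟨w, z⟩
    by_cases hwK : w ∈ K
    · have : (fun p : ℂ × K => h p.1 * E p.1 * (p.1 - (p.2 : ℂ))⁻¹) =ᶠ[𝓝 (w, z)] fun _ => 0 := by
        filter_upwards [continuousAt_fst.eventually (hEK w hwK)] with p hp
        simp [hp]
      exact continuousAt_const.congr this.symm
    by_cases hwt : w ∈ t
    · have h1 : ContinuousAt h w :=
        (hh.differentiableAt (hU.mem_nhds (htU hwt))).continuousAt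
      have h2 : ContinuousAt (fun p : ℂ × K => h p.1) (w, z) :=
        ContinuousAt.comp (f := fun p : ℂ × K => p.1) (x := (w, z)) h1 continuousAt_fst
      refine (h2.mul (by fun_prop)).mul (ContinuousAt.inv₀ (by fun_prop) ?_)
      intro h0
      have h3 : w = (z : ℂ) := sub_eq_zero.1 h0
      exact hwK (h3 ▸ z.2)
    · have : (fun p : ℂ × K => h p.1 * E p.1 * (p.1 - (p.2 : ℂ))⁻¹) =ᶠ[𝓝 (w, z)] fun _ => 0 := by
        filter_upwards [continuousAt_fst.eventually (htc w hwt)] with p hp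
        simp [hEt _ hp]
      exact continuousAt_const.congr this.symm
  have hΨc : Continuous Ψ := by
    refine Continuous.subtype_mk (f := fun w => (Ψ w : C(K, ℂ))) ?_ (fun w => (Ψ w).2)
    refine ContinuousMap.continuous_of_continuous_uncurry _ ?_
    refine hker.congr fun p => ?_
    exact (hΨ p.1 p.2).symm
  obtain ⟨M, hM, htM⟩ := ht.isBounded.subset_ball_lt 0 0
  have hA : 0 < 2 * M := by linarith
  let c : ℂ := 4 * (2 * M : ℝ) * Complex.I *
    ((∫ t : ℝ in (-(2 * M))..(2 * M), (t ^ 2 + (2 * M) ^ 2)⁻¹ : ℝ) : ℂ)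
  have hc : c ≠ 0 := square_const_ne_zero (2 * M) hA
  let J : S := ∫ x : ℝ in (-M)..M, ∫ y : ℝ in (-M)..M, Ψ (x + y * Complex.I)
  have hJ : ∀ z : K, (J : C(K, ℂ)) z = -c * h z := by
    intro z
    have hzM : ‖(z : ℂ)‖ < M := by simpa using htM (hKt z.2)
    let ev : S →L[ℂ] ℂ := (ContinuousMap.evalCLM ℂ z).comp
      (Subalgebra.toSubmodule S).subtypeL
    let D : ℂ → ℂ := fun w => h w * E w * (w - z)⁻¹
    have hD : Continuous D := hker.comp (by fun_prop : Continuous fun w : ℂ => (w, z))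
    have hDt : ∀ w, D w ≠ 0 → ‖w‖ < M := fun w hw => by
      have : w ∈ t := by
        by_contra hwt
        exact hw (by simp [D, hEt w hwt])
      simpa using htM this
    have hev : ∀ w, ev (Ψ w) = D w := fun w => hΨ w z
    have hinner : Continuous fun x : ℝ => ∫ y : ℝ in (-M)..M, Ψ (x + y * Complex.I) := by
      refine intervalIntegral.continuous_parametric_intervalIntegral_of_continuous'
        (f := fun x y : ℝ => Ψ (x + y * Complex.I)) ?_ _ _
      exact hΨc.comp (by fun_prop)
    have e1 : (J : C(K, ℂ)) z =
        ∫ x : ℝ in (-M)..M, ∫ y : ℝ in (-M)..M, D (x + y * Complex.I) := by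
      change ev J = _
      rw [← ContinuousLinearMap.intervalIntegral_comp_comm ev (hinner.intervalIntegrable _ _)]
      refine intervalIntegral.integral_congr fun x _ => ?_
      change ev _ = _
      have hcx : Continuous fun y : ℝ => Ψ (x + y * Complex.I) := hΨc.comp (by fun_prop)
      rw [← ContinuousLinearMap.intervalIntegral_comp_comm ev (hcx.intervalIntegrable _ _)]
      simp only [hev]
    have hz1 := (abs_lt.1 ((Complex.abs_re_le_norm z).trans_lt hzM))
    have hz2 := (abs_lt.1 ((Complex.abs_im_le_norm z).trans_lt hzM))
    have hre : ∀ x y : ℝ, D (x + y * Complex.I) ≠ 0 → -M < x ∧ x < M := fun x y hxy => by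
      have := (Complex.abs_re_le_norm _).trans_lt (hDt _ hxy)
      simpa [abs_lt] using this
    have him : ∀ x y : ℝ, D (x + y * Complex.I) ≠ 0 → -M < y ∧ y < M := fun x y hxy => by
      have := (Complex.abs_im_le_norm _).trans_lt (hDt _ hxy)
      simpa [abs_lt] using this
    have gen : ∀ a b a' b' : ℝ, a ≤ -M → M ≤ b → a' ≤ -M → M ≤ b' →
        (∫ x : ℝ in a..b, ∫ y : ℝ in a'..b', D (x + y * Complex.I)) =
        ∫ x : ℝ, ∫ y : ℝ, D (x + y * Complex.I) := by
      intro a b a' b' h1 h2 h3 h4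
      have hin : ∀ x : ℝ, (∫ y : ℝ in a'..b', D (x + y * Complex.I)) =
          ∫ y : ℝ, D (x + y * Complex.I) := fun x => by
        refine intervalIntegral.integral_eq_integral_of_support_subset fun y hy => ?_
        have := him x y hy
        exact ⟨by linarith, by linarith⟩
      simp only [hin]
      refine intervalIntegral.integral_eq_integral_of_support_subset fun x hx => ?_
      by_contra hnot
      refine hx ?_
      have : ∀ y : ℝ, D (x + y * Complex.I) = 0 := fun y => by
        by_contra hne
        have := hre x y hne
        exact hnot ⟨by linarith, by linarith⟩
      simp [this]
    have huz : u =ᶠ[𝓝 (z : ℂ)] h := by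
      filter_upwards [hχ1 z z.2] with w hw
      simp [u, hw]
    have e2 := pompeiu u u' hu z
      ((hh.differentiableAt (hU.mem_nhds (hKU z.2))).congr_of_eventuallyEq huz) (2 * M) hA
      (fun w hw => by
        refine (hu_out w fun hwt => ?_).self_of_nhds
        have h1 : ‖w‖ < M := by simpa using htM hwt
        have h2 := norm_sub_le w z
        linarith) D hD (fun w hw => by
          rw [hdbar]
          have := sub_ne_zero.2 hw
          simp only [D]
          field_simp)
    rw [gen _ _ _ _ (by linarith) (by linarith) (by linarith) (by linarith)] at e2
    rw [e1, gen _ _ _ _ le_rfl le_rfl le_rfl le_rfl, e2, huz.self_of_nhds]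
  have hmem : ((((-c)⁻¹ • J : S) : C(K, ℂ))) ∈ closure (polynomialFunctions K : Set C(K, ℂ)) :=
    ((-c)⁻¹ • J).2
  obtain ⟨q, ⟨p, -, rfl⟩, hq⟩ := Metric.mem_closure_iff.1 hmem ε hε
  refine ⟨p, fun z hz => ?_⟩
  have h1 := (ContinuousMap.dist_apply_le_dist (⟨z, hz⟩ : K)).trans_lt hq
  have h2 : (((-c)⁻¹ • J : S) : C(K, ℂ)) ⟨z, hz⟩ = (-c)⁻¹ * (J : C(K, ℂ)) ⟨z, hz⟩ := rfl
  rw [h2, hJ, inv_mul_cancel_left₀ (neg_ne_zero.2 hc), dist_comm, dist_eq_norm] at h1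
  simpa using h1

lemma runge_list {K U : Set ℂ} (hK : IsCompact K) (hlog : ∀ a ∉ K, HasLogOn K a)
    (hU : IsOpen U) (hKU : K ⊆ U) (l : List ℂ) (hl : ∀ x ∈ l, x ∈ K) :
    ∀ (h : ℂ → ℂ) (_ : DifferentiableOn ℂ h U) (ε : ℝ) (_ : 0 < ε),
      ∃ g r : ℂ → ℂ, Differentiable ℂ g ∧ DifferentiableOn ℂ r U ∧
        (∀ z ∈ K, ‖g z - h z‖ < ε) ∧
        ∀ z, g z - h z = (l.map fun x => z - x).prod * r z := by
  induction l with
  | nil =>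
    intro h hh ε hε
    obtain ⟨p, hp⟩ := runge_base hK hlog hU hKU hh hε
    refine ⟨fun z => p.eval z, fun z => p.eval z - h z, p.differentiable,
      p.differentiable.differentiableOn.sub hh, hp, fun z => by simp⟩
  | cons x l ih =>
    intro h hh ε hε
    have hxU : x ∈ U := hKU (hl x (by simp))
    have hd : DifferentiableOn ℂ (dslope h x) U :=
      (Complex.differentiableOn_dslope (hU.mem_nhds hxU)).2 hh
    obtain ⟨R, hR⟩ := hK.isBounded.exists_norm_le
    have hC : 0 < |R| + ‖x‖ + 1 := by positivity
    obtain ⟨g, r, hg, hr, happ, heq⟩ := ih (fun y hy => hl y (by simp [hy])) (dslope h x) hd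
      (ε / (|R| + ‖x‖ + 1)) (by positivity)
    have key : ∀ z, h x + (z - x) * g z - h z = (z - x) * (g z - dslope h x z) := fun z => by
      have := sub_smul_dslope h x z
      rw [smul_eq_mul] at this
      linear_combination this
    refine ⟨fun z => h x + (z - x) * g z, r, by fun_prop, hr, fun z hz => ?_, fun z => ?_⟩
    · rw [key, norm_mul]
      have h1 := happ z hz
      rw [lt_div_iff₀ hC] at h1
      have h2 : ‖z - x‖ ≤ |R| + ‖x‖ + 1 := by
        have := norm_sub_le z x
        have := hR z hz
        have := le_abs_self R
        linarith
      calc ‖z - x‖ * ‖g z - dslope h x z‖ ≤ (|R| + ‖x‖ + 1) * ‖g z - dslope h x z‖ := by gcongr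
        _ < ε := by rwa [mul_comm]
    · simp only [List.map_cons, List.prod_cons]
      rw [key, heq z, mul_assoc]

/-- Gluing holomorphic functions near pairwise disjoint compact sets. -/
lemma glue {n : ℕ} {K : Fin n → Set ℂ} (hK : ∀ k, IsCompact (K k))
    (hdisj : Pairwise (Function.onFun Disjoint K))
    (f : Fin n → ℂ → ℂ) (U : Fin n → Set ℂ)
    (hUopen : ∀ k, IsOpen (U k)) (hKU : ∀ k, K k ⊆ U k)
    (hf : ∀ k, DifferentiableOn ℂ (f k) (U k)) :
    ∃ (h : ℂ → ℂ) (V : Set ℂ), IsOpen V ∧ (⋃ k, K k) ⊆ V ∧ DifferentiableOn ℂ h V ∧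
      ∀ k, ∀ z ∈ K k, h =ᶠ[𝓝 z] f k := by
  classical
  let W : Fin n → Set ℂ := fun k =>
    U k ∩ ⋂ j, ⋂ (_ : j ≠ k), {z | Metric.infEDist z (K k) < Metric.infEDist z (K j)}
  have hWo : ∀ k, IsOpen (W k) := fun k => by
    refine (hUopen k).inter (isOpen_iInter_of_finite fun j => isOpen_iInter_of_finite fun _ => ?_)
    exact isOpen_lt Metric.continuous_infEDist Metric.continuous_infEDist
  have hKW : ∀ k, K k ⊆ W k := fun k z hz => by
    refine ⟨hKU k hz, mem_iInter₂.2 fun j hj => ?_⟩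
    have hzj : z ∉ K j := fun h => Set.disjoint_left.1 (hdisj hj) h hz
    change Metric.infEDist z (K k) < Metric.infEDist z (K j)
    rw [Metric.infEDist_zero_of_mem hz, pos_iff_ne_zero]
    intro h0
    exact hzj ((Metric.mem_iff_infEDist_zero_of_closed (hK j).isClosed).2 h0)
  have huniq : ∀ z j k, z ∈ W j → z ∈ W k → j = k := fun z j k hj hk => by
    by_contra hne
    have h1 := mem_iInter₂.1 hj.2 k (Ne.symm hne)
    have h2 := mem_iInter₂.1 hk.2 j hne
    exact lt_asymm (a := Metric.infEDist z (K j)) h1 h2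
  let h : ℂ → ℂ := fun z => if hz : ∃ k, z ∈ W k then f hz.choose z else 0
  have hh : ∀ k, ∀ z ∈ W k, h z = f k z := fun k z hz => by
    have hex : ∃ k, z ∈ W k := ⟨k, hz⟩
    have : hex.choose = k := huniq z _ _ hex.choose_spec hz
    simp only [h, dif_pos hex, this]
  have hev : ∀ k, ∀ z ∈ W k, h =ᶠ[𝓝 z] f k := fun k z hz => by
    filter_upwards [(hWo k).mem_nhds hz] with w hw using hh k w hw
  refine ⟨h, ⋃ k, W k, isOpen_iUnion hWo, iUnion_mono hKW, fun z hz => ?_,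
    fun k z hz => hev k z (hKW k hz)⟩
  obtain ⟨k, hk⟩ := mem_iUnion.1 hz
  exact (((hf k).differentiableAt ((hUopen k).mem_nhds hk.1)).congr_of_eventuallyEq
    (hev k z hk)).differentiableWithinAt

theorem runge_with_jet_interpolation
    (n : ℕ) (K : Fin n → Set ℂ) (hK : ∀ k, IsCompact (K k))
    (hdisj : Pairwise (Function.onFun Disjoint K))
    (hconn : ∀ k, IsConnected (K k)ᶜ)
    (L : Fin n → Finset ℂ) (hL : ∀ k, ↑(L k) ⊆ K k)
    (f : Fin n → ℂ → ℂ) (U : Fin n → Set ℂ)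
    (hUopen : ∀ k, IsOpen (U k)) (hKU : ∀ k, K k ⊆ U k)
    (hf : ∀ k, DifferentiableOn ℂ (f k) (U k))
    (ε : ℝ) (hε : 0 < ε) :
    ∃ g : ℂ → ℂ, Differentiable ℂ g ∧
      ∀ k, (∀ z ∈ K k, ‖g z - f k z‖ < ε) ∧
        (∀ x ∈ L k, g x = f k x ∧ deriv g x = deriv (f k) x) := by
  classical
  obtain ⟨h, V, hV, hKV, hh, hev⟩ := glue hK hdisj f U hUopen hKU hf
  let l : List ℂ := (Finset.univ.biUnion L).toList
  have hmem : ∀ x, x ∈ l ↔ ∃ k, x ∈ L k := fun x => by simp [l]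
  have hlK : ∀ x ∈ l ++ l, x ∈ ⋃ k, K k := fun x hx => by
    have hx' : x ∈ l := by simpa using hx
    obtain ⟨k, hk⟩ := (hmem x).1 hx'
    exact mem_iUnion.2 ⟨k, hL k hk⟩
  obtain ⟨g, r, hg, hr, happ, heq⟩ := runge_list (isCompact_iUnion hK)
    (fun a ha => hasLogOn_iUnion hK hdisj fun k => hasLogOn_of_compl (hK k)
      (hconn k).isPreconnected fun hak => ha (mem_iUnion.2 ⟨k, hak⟩)) hV hKV (l ++ l) hlK h hh ε hε
  refine ⟨g, hg, fun k => ⟨fun z hz => ?_, fun x hx => ?_⟩⟩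
  · rw [← (hev k z hz).self_of_nhds]
    exact happ z (mem_iUnion.2 ⟨k, hz⟩)
  · have hxK : x ∈ K k := hL k hx
    have hxV : V ∈ 𝓝 x := hV.mem_nhds (hKV (mem_iUnion.2 ⟨k, hxK⟩))
    have hxl : x ∈ l := (hmem x).2 ⟨k, hx⟩
    let P : ℂ → ℂ := fun z => (l.map fun y => z - y).prod
    have hP0 : P x = 0 := by
      refine List.prod_eq_zero ?_
      exact List.mem_map.2 ⟨x, hxl, sub_self x⟩
    have hPd : Differentiable ℂ P := by
      have : ∀ m : List ℂ, Differentiable ℂ fun z : ℂ => (m.map fun y => z - y).prod := by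
        intro m
        induction m with
        | nil => simp
        | cons y m ih =>
          simp only [List.map_cons, List.prod_cons]
          fun_prop
      exact this l
    have heq' : ∀ z, g z = h z + P z * (P z * r z) := fun z => by
      have := heq z
      rw [List.map_append, List.prod_append] at this
      simp only [P]
      linear_combination this
    have hhd := (hh.differentiableAt hxV).hasDerivAt
    have hrd := (hr.differentiableAt hxV).hasDerivAt
    have hPx := (hPd x).hasDerivAt
    have hder := hhd.add (hPx.mul (hPx.mul hrd))
    have hgder : HasDerivAt g (deriv h x) x := by
      have h1 : g = h + P * (P * r) := funext heq'
      rw [h1]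
      have h2 : deriv h x + (deriv P x * (P * r) x + P x * (deriv P x * r x + P x * deriv r x))
          = deriv h x := by
        rw [Pi.mul_apply, hP0]
        ring
      rw [h2] at hder
      exact hder
    refine ⟨?_, ?_⟩
    · rw [heq' x, hP0, (hev k x hxK).self_of_nhds]
      simp
    · rw [hgder.deriv, (hev k x hxK).deriv_eq]
end

section
/- Let Ω ⊆ ℂ be a bounded connected regular open set such that ℂ \ closure(Ω) is connected. Then Ω is simply connected. -/
open CategoryTheory

/-- Two cells of the grid share an edge. -/
def GridAdj (a b : ℤ × ℤ) : Prop :=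
  (a.1 = b.1 ∧ (a.2 = b.2 + 1 ∨ b.2 = a.2 + 1)) ∨ (a.2 = b.2 ∧ (a.1 = b.1 + 1 ∨ b.1 = a.1 + 1))

/-- Signed crossing number of the step `a → b` with the upward ray starting at `p`. -/
def gridCross (p a b : ℤ × ℤ) : ℤ :=
  if a.1 = p.1 ∧ b.1 = p.1 + 1 ∧ a.2 = b.2 ∧ p.2 < a.2 then 1
  else if b.1 = p.1 ∧ a.1 = p.1 + 1 ∧ a.2 = b.2 ∧ p.2 < a.2 then -1 else 0

theorem gridCross_vert (p : ℤ × ℤ) (x y z : ℤ) : gridCross p (x, y) (x, z) = 0 := by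
  unfold gridCross
  simp only
  rw [if_neg (by omega), if_neg (by omega)]

theorem gridCross_right (p : ℤ × ℤ) (x y : ℤ) :
    gridCross p (x, y) (x + 1, y) = if x = p.1 ∧ p.2 < y then 1 else 0 := by
  unfold gridCross
  grind

theorem gridCross_left (p : ℤ × ℤ) (x y : ℤ) :
    gridCross p (x + 1, y) (x, y) = if x = p.1 ∧ p.2 < y then -1 else 0 := by
  unfold gridCross
  grind

/-- The crossing cocycle of `p` is a coboundary on `G`. -/
def GridTriv (G : Set (ℤ × ℤ)) (p : ℤ × ℤ) : Prop :=
  ∃ f : ℤ × ℤ → ℤ, ∀ a ∈ G, ∀ b ∈ G, GridAdj a b → gridCross p a b = f b - f a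

theorem gridTriv_of_near {G : Set (ℤ × ℤ)} {p q : ℤ × ℤ} (hp : p ∉ G) (hq : q ∉ G)
    (h1 : |p.1 - q.1| ≤ 1) (h2 : |p.2 - q.2| ≤ 1) (h : GridTriv G p) : GridTriv G q := by
  obtain ⟨f, hf⟩ := h
  refine ⟨fun a => f a - (if q.1 = p.1 + 1 ∧ a.1 = q.1 ∧ q.2 < a.2 then 1 else 0)
    + (if p.1 = q.1 + 1 ∧ a.1 = p.1 ∧ p.2 < a.2 then 1 else 0), ?_⟩
  intro a ha b hb hab
  have key := hf a ha b hb hab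
  have hap : ¬ (a.1 = p.1 ∧ a.2 = p.2) := fun h => hp (by rwa [← Prod.ext h.1 h.2])
  have haq : ¬ (a.1 = q.1 ∧ a.2 = q.2) := fun h => hq (by rwa [← Prod.ext h.1 h.2])
  have hbp : ¬ (b.1 = p.1 ∧ b.2 = p.2) := fun h => hp (by rwa [← Prod.ext h.1 h.2])
  have hbq : ¬ (b.1 = q.1 ∧ b.2 = q.2) := fun h => hq (by rwa [← Prod.ext h.1 h.2])
  rw [abs_le] at h1 h2
  have : gridCross q a b - gridCross p a b =
    - ((if q.1 = p.1 + 1 ∧ b.1 = q.1 ∧ q.2 < b.2 then 1 else 0)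
       - (if q.1 = p.1 + 1 ∧ a.1 = q.1 ∧ q.2 < a.2 then 1 else 0))
    + ((if p.1 = q.1 + 1 ∧ b.1 = p.1 ∧ p.2 < b.2 then 1 else 0)
       - (if p.1 = q.1 + 1 ∧ a.1 = p.1 ∧ p.2 < a.2 then 1 else 0)) := by
    clear key hf
    obtain ⟨a1, a2⟩ := a
    obtain ⟨b1, b2⟩ := b
    obtain ⟨p1, p2⟩ := p
    obtain ⟨q1, q2⟩ := q
    unfold GridAdj at hab
    simp only at *
    clear ha hb hp hq f
    rcases hab with ⟨rfl, rfl | rfl⟩ | ⟨rfl, rfl | rfl⟩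
    · rw [gridCross_vert, gridCross_vert]
      rcases (by omega : q1 = p1 ∨ q1 = p1 + 1 ∨ p1 = q1 + 1) with rfl | rfl | rfl <;>
        split_ifs <;> omega
    · rw [gridCross_vert, gridCross_vert]
      rcases (by omega : q1 = p1 ∨ q1 = p1 + 1 ∨ p1 = q1 + 1) with rfl | rfl | rfl <;>
        split_ifs <;> omega
    · rw [gridCross_left, gridCross_left]
      rcases (by omega : q1 = p1 ∨ q1 = p1 + 1 ∨ p1 = q1 + 1) with rfl | rfl | rfl <;>
        split_ifs <;> omega
    · rw [gridCross_right, gridCross_right]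
      rcases (by omega : q1 = p1 ∨ q1 = p1 + 1 ∨ p1 = q1 + 1) with rfl | rfl | rfl <;>
        split_ifs <;> omega
  simp only
  linarith

theorem grid_potential {C : Type*} [Groupoid C] (X : C) (hX : ∀ Y : C, Nonempty (Y ⟶ X))
    (c : ℤ × ℤ → C) (E : ∀ a b, c a ⟶ c b) (n : ℕ) :
    ∀ G : Finset (ℤ × ℤ), G.card = n →
    (∀ a ∈ G, ∀ b ∈ G, GridAdj a b → E a b ≫ E b a = 𝟙 _) →
    (∀ x y : ℤ, (x, y) ∈ G → (x - 1, y) ∈ G → (x, y - 1) ∈ G → (x - 1, y - 1) ∈ G →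
      E (x, y) (x - 1, y) ≫ E (x - 1, y) (x - 1, y - 1) =
      E (x, y) (x, y - 1) ≫ E (x, y - 1) (x - 1, y - 1)) →
    (∀ p ∉ G, GridTriv (G : Set (ℤ × ℤ)) p) →
    ∃ t : ∀ a, c a ⟶ X, ∀ a ∈ G, ∀ b ∈ G, GridAdj a b → E a b ≫ t b = t a := by
  classical
  induction n with
  | zero =>
    intro G hG _ _ _
    rw [Finset.card_eq_zero] at hG
    subst hG
    exact ⟨fun a => (hX _).some, by simp⟩
  | succ n ih =>
    intro G hG hinv hsq htr
    have hne : G.Nonempty := Finset.card_pos.mp (by omega)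
    obtain ⟨v, hv, hmax⟩ : ∃ v ∈ G, ∀ a ∈ G, a.2 < v.2 ∨ (a.2 = v.2 ∧ a.1 ≤ v.1) := by
      obtain ⟨u, hu, hu'⟩ := G.exists_max_image (fun a => a.2) hne
      obtain ⟨v, hv, hv'⟩ := (G.filter (fun a => a.2 = u.2)).exists_max_image (fun a => a.1)
        ⟨u, by simp [hu]⟩
      simp only [Finset.mem_filter] at hv hv'
      refine ⟨v, hv.1, fun a ha => ?_⟩
      have h1 := hu' a ha
      by_cases h : a.2 = u.2
      · right; exact ⟨by omega, hv' a ⟨ha, h⟩⟩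
      · left; omega
    obtain ⟨x, y⟩ := v
    simp only at hmax
    -- it suffices to extend
    have ext : ∀ (t : ∀ a, c a ⟶ X) (s : c (x, y) ⟶ X),
        (∀ a ∈ G.erase (x, y), ∀ b ∈ G.erase (x, y), GridAdj a b → E a b ≫ t b = t a) →
        ((x - 1, y) ∈ G → E (x, y) (x - 1, y) ≫ t (x - 1, y) = s) →
        ((x, y - 1) ∈ G → E (x, y) (x, y - 1) ≫ t (x, y - 1) = s) →
        ∃ t : ∀ a, c a ⟶ X, ∀ a ∈ G, ∀ b ∈ G, GridAdj a b → E a b ≫ t b = t a := by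
      intro t s ht hL hD
      have hvb : ∀ b ∈ G, GridAdj (x, y) b → E (x, y) b ≫ t b = s := by
        rintro ⟨b1, b2⟩ hb hab
        have := hmax _ hb
        unfold GridAdj at hab
        simp only at this hab
        rcases (by omega : (b1 = x - 1 ∧ b2 = y) ∨ (b1 = x ∧ b2 = y - 1)) with ⟨rfl, rfl⟩ | ⟨rfl, rfl⟩
        · exact hL hb
        · exact hD hb
      have hsymm : ∀ a b, GridAdj a b → GridAdj b a := by
        intro a b h; unfold GridAdj at *; omega
      refine ⟨Function.update t (x, y) s, fun a ha b hb hab => ?_⟩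
      by_cases hav : a = (x, y)
      · subst hav
        have hbv : b ≠ (x, y) := by
          rintro rfl; unfold GridAdj at hab; omega
        rw [Function.update_self, Function.update_of_ne hbv]
        exact hvb b hb hab
      · by_cases hbv : b = (x, y)
        · subst hbv
          rw [Function.update_self, Function.update_of_ne hav, ← hvb a ha (hsymm _ _ hab),
            ← Category.assoc, hinv a ha _ hb hab, Category.id_comp]
        · rw [Function.update_of_ne hav, Function.update_of_ne hbv]
          exact ht a (Finset.mem_erase.2 ⟨hav, ha⟩) b (Finset.mem_erase.2 ⟨hbv, hb⟩) hab
    obtain ⟨t, ht⟩ := ih (G.erase (x, y)) (by rw [Finset.card_erase_of_mem hv]; omega)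
      (fun a ha b hb => hinv a (Finset.mem_of_mem_erase ha) b (Finset.mem_of_mem_erase hb))
      (fun x' y' h1 h2 h3 h4 => hsq x' y' (Finset.mem_of_mem_erase h1) (Finset.mem_of_mem_erase h2)
        (Finset.mem_of_mem_erase h3) (Finset.mem_of_mem_erase h4))
      (by
        intro p hp
        by_cases hpv : p = (x, y)
        · subst hpv
          refine ⟨fun _ => 0, fun a ha b hb _ => ?_⟩
          have h1 := hmax a (Finset.mem_of_mem_erase ha)
          unfold gridCross
          simp only
          split_ifs <;> omega
        · obtain ⟨f, hf⟩ := htr p (fun h => hp (Finset.mem_erase.2 ⟨hpv, h⟩))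
          exact ⟨f, fun a ha b hb => hf a (Finset.mem_of_mem_erase ha) b
            (Finset.mem_of_mem_erase hb)⟩)
    by_cases hL : (x - 1, y) ∈ G
    · by_cases hD : (x, y - 1) ∈ G
      · have hLe : (x - 1, y) ∈ G.erase (x, y) := by simp [hL]
        have hDe : (x, y - 1) ∈ G.erase (x, y) := by simp [hD]
        by_cases hZ : (x - 1, y - 1) ∈ G
        · have hZe : (x - 1, y - 1) ∈ G.erase (x, y) := by simp [hZ]
          refine ext t (E (x, y) (x - 1, y) ≫ t (x - 1, y)) ht (fun _ => rfl) (fun _ => ?_)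
          rw [← ht _ hLe _ hZe (by unfold GridAdj; simp), ← ht _ hDe _ hZe (by unfold GridAdj; simp),
            ← Category.assoc, ← Category.assoc, hsq x y hv hL hD hZ]
        · obtain ⟨f, hf⟩ := htr _ hZ
          have e1 := hf _ hL _ hv (by unfold GridAdj; simp)
          have e2 := hf _ hD _ hv (by unfold GridAdj; simp)
          have e1' : gridCross (x - 1, y - 1) (x - 1, y) (x, y) = 1 := by simp [gridCross]
          have e2' : gridCross (x - 1, y - 1) (x, y - 1) (x, y) = 0 := by simp [gridCross]
          have hne : f (x - 1, y) ≠ f (x, y - 1) := by omega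
          have hconst : ∀ a ∈ G.erase (x, y), ∀ b ∈ G.erase (x, y), GridAdj a b → f a = f b := by
            intro a ha b hb hab
            have h := hf a (Finset.mem_of_mem_erase ha) b (Finset.mem_of_mem_erase hb) hab
            have h1 := hmax a (Finset.mem_of_mem_erase ha)
            have h2 := hmax b (Finset.mem_of_mem_erase hb)
            have h3 : ¬ (a.1 = x ∧ a.2 = y) := fun h => (Finset.ne_of_mem_erase ha) (Prod.ext h.1 h.2)
            have h4 : ¬ (b.1 = x ∧ b.2 = y) := fun h => (Finset.ne_of_mem_erase hb) (Prod.ext h.1 h.2)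
            have h5 : gridCross (x - 1, y - 1) a b = 0 := by
              unfold gridCross
              simp only
              split_ifs <;> omega
            omega
          let g : X ⟶ X := inv (t (x, y - 1)) ≫ inv (E (x, y) (x, y - 1)) ≫
            E (x, y) (x - 1, y) ≫ t (x - 1, y)
          refine ext (fun a => if f a = f (x, y - 1) then t a ≫ g else t a)
            (E (x, y) (x - 1, y) ≫ t (x - 1, y)) ?_ ?_ ?_
          · intro a ha b hb hab
            have := hconst a ha b hb hab
            simp only [this]
            split_ifs
            · rw [← Category.assoc, ht a ha b hb hab]
            · exact ht a ha b hb hab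
          · intro _
            simp [hne]
          · intro _
            simp [g]
      · exact ext t (E (x, y) (x - 1, y) ≫ t (x - 1, y)) ht (fun _ => rfl) (fun h => absurd h hD)
    · exact ext t (E (x, y) (x, y - 1) ≫ t (x, y - 1)) ht (fun h => absurd h hL) (fun _ => rfl)

theorem convex_homotopic {Ω C : Set ℂ} (hC : Convex ℝ C) (hCΩ : C ⊆ Ω) {z w : Ω} (p q : Path z w)
    (hp : ∀ t, (p t : ℂ) ∈ C) (hq : ∀ t, (q t : ℂ) ∈ C) : p.Homotopic q := by
  have hz : (z : ℂ) ∈ C := by simpa using hp 0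
  have hw : (w : ℂ) ∈ C := by simpa using hp 1
  have : ContractibleSpace C := hC.contractibleSpace ⟨_, hz⟩
  let p' : Path (⟨z, hz⟩ : C) ⟨w, hw⟩ :=
    { toFun := fun t => ⟨p t, hp t⟩
      continuous_toFun := by fun_prop
      source' := by simp
      target' := by simp }
  let q' : Path (⟨z, hz⟩ : C) ⟨w, hw⟩ :=
    { toFun := fun t => ⟨q t, hq t⟩
      continuous_toFun := by fun_prop
      source' := by simp
      target' := by simp }
  have h := SimplyConnectedSpace.paths_homotopic p' q'
  exact h.map ⟨Set.inclusion hCΩ, continuous_inclusion hCΩ⟩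

open Classical in
/-- The homotopy class of the segment from `z` to `w` (junk if it leaves `Ω`). -/
noncomputable def segClass {Ω : Set ℂ} [PathConnectedSpace Ω] (z w : Ω) :
    FundamentalGroupoid.mk z ⟶ FundamentalGroupoid.mk w :=
  if h : ∃ p : Path z w, ∀ t, (p t : ℂ) ∈ segment ℝ (z : ℂ) w then
    Path.Homotopic.Quotient.mk h.choose
  else Path.Homotopic.Quotient.mk (PathConnectedSpace.somePath z w)

theorem exists_seg {Ω C : Set ℂ} (hC : Convex ℝ C) (hCΩ : C ⊆ Ω)
    {z w : Ω} (hz : (z : ℂ) ∈ C) (hw : (w : ℂ) ∈ C) :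
    ∃ p : Path z w, ∀ t, (p t : ℂ) ∈ segment ℝ (z : ℂ) w := by
  have h1 : IsPathConnected (segment ℝ (z : ℂ) w) :=
    (convex_segment _ _).isPathConnected ⟨_, left_mem_segment ℝ _ _⟩
  obtain ⟨p, hp⟩ := h1.joinedIn _ (left_mem_segment ℝ _ _) _ (right_mem_segment ℝ _ _)
  have hsub := hC.segment_subset hz hw
  exact ⟨{ toFun := fun t => ⟨p t, hCΩ (hsub (hp t))⟩
           continuous_toFun := by fun_prop
           source' := by simp
           target' := by simp }, hp⟩

theorem mk_eq_segClass {Ω C : Set ℂ} [PathConnectedSpace Ω] (hC : Convex ℝ C) (hCΩ : C ⊆ Ω)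
    {z w : Ω} (p : Path z w) (hp : ∀ t, (p t : ℂ) ∈ C) :
    Path.Homotopic.Quotient.mk p = segClass z w := by
  have hz : (z : ℂ) ∈ C := by simpa using hp 0
  have hw : (w : ℂ) ∈ C := by simpa using hp 1
  have h := exists_seg hC hCΩ hz hw
  unfold segClass
  rw [dif_pos h]
  exact Quotient.sound (convex_homotopic hC hCΩ _ _ hp
    (fun t => hC.segment_subset hz hw (h.choose_spec t)))

theorem segClass_comp {Ω C : Set ℂ} [PathConnectedSpace Ω] (hC : Convex ℝ C) (hCΩ : C ⊆ Ω)
    {z w u : Ω} (hz : (z : ℂ) ∈ C) (hw : (w : ℂ) ∈ C) (hu : (u : ℂ) ∈ C) :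
    segClass z w ≫ segClass w u = segClass z u := by
  obtain ⟨p, hp⟩ := exists_seg hC hCΩ hz hw
  obtain ⟨q, hq⟩ := exists_seg hC hCΩ hw hu
  have hp' := fun t => hC.segment_subset hz hw (hp t)
  have hq' := fun t => hC.segment_subset hw hu (hq t)
  rw [← mk_eq_segClass hC hCΩ p hp', ← mk_eq_segClass hC hCΩ q hq',
    ← mk_eq_segClass hC hCΩ (p.trans q)]
  · rfl
  · intro t
    rw [Path.trans_apply]
    split_ifs
    · exact hp' _
    · exact hq' _

theorem segClass_self {Ω : Set ℂ} [PathConnectedSpace Ω] (z : Ω) : segClass z z = 𝟙 _ := by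
  rw [← mk_eq_segClass (convex_singleton (z : ℂ)) (by simp) (Path.refl z) (by simp)]
  rfl

/-- The cell of the grid of mesh `ε` containing `z`. -/
noncomputable def cell (ε : ℝ) (z : ℂ) : ℤ × ℤ := (⌊z.re / ε⌋, ⌊z.im / ε⌋)

/-- The centre of a cell. -/
noncomputable def cellCenter (ε : ℝ) (p : ℤ × ℤ) : ℂ := ⟨(p.1 + 1 / 2) * ε, (p.2 + 1 / 2) * ε⟩

theorem cell_center {ε : ℝ} (hε : 0 < ε) (p : ℤ × ℤ) : cell ε (cellCenter ε p) = p := by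
  unfold cell cellCenter
  ext
  · simp only [mul_div_cancel_right₀ _ hε.ne']
    rw [Int.floor_eq_iff]; constructor <;> linarith
  · simp only [mul_div_cancel_right₀ _ hε.ne']
    rw [Int.floor_eq_iff]; constructor <;> linarith

theorem cell_near {ε : ℝ} (hε : 0 < ε) {z w : ℂ} (h : ‖z - w‖ < ε) :
    |(cell ε z).1 - (cell ε w).1| ≤ 1 ∧ |(cell ε z).2 - (cell ε w).2| ≤ 1 := by
  have key : ∀ a b : ℝ, |a - b| < ε → |⌊a / ε⌋ - ⌊b / ε⌋| ≤ 1 := by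
    intro a b hab
    have : |a / ε - b / ε| < 1 := by
      rw [← sub_div, abs_div, abs_of_pos hε, div_lt_one hε]; exact hab
    rw [abs_lt] at this
    have h1 := Int.floor_le (a / ε)
    have h2 := Int.lt_floor_add_one (a / ε)
    have h3 := Int.floor_le (b / ε)
    have h4 := Int.lt_floor_add_one (b / ε)
    rw [abs_le]
    constructor
    · have : (⌊b / ε⌋ : ℝ) < ⌊a / ε⌋ + 2 := by linarith
      have : ⌊b / ε⌋ < ⌊a / ε⌋ + 2 := by exact_mod_cast this
      omega
    · have : (⌊a / ε⌋ : ℝ) < ⌊b / ε⌋ + 2 := by linarith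
      have : ⌊a / ε⌋ < ⌊b / ε⌋ + 2 := by exact_mod_cast this
      omega
  exact ⟨key _ _ (lt_of_le_of_lt (by simpa using Complex.abs_re_le_norm (z - w)) h),
    key _ _ (lt_of_le_of_lt (by simpa using Complex.abs_im_le_norm (z - w)) h)⟩

/-- The points whose cells lie in a rectangle of cells form a convex set. -/
theorem convex_cells {ε : ℝ} (hε : 0 < ε) (a b : ℤ × ℤ) :
    Convex ℝ {z | cell ε z ∈ Set.Icc a b} := by
  have : {z | cell ε z ∈ Set.Icc a b} =
      (Complex.reLm ⁻¹' Set.Ico (a.1 * ε) ((b.1 + 1) * ε)) ∩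
      (Complex.imLm ⁻¹' Set.Ico (a.2 * ε) ((b.2 + 1) * ε)) := by
    ext z
    have key : ∀ (u : ℝ) (m n : ℤ), (m ≤ ⌊u / ε⌋ ∧ ⌊u / ε⌋ ≤ n) ↔
        u ∈ Set.Ico (m * ε) ((n + 1) * ε) := by
      intro u m n
      rw [Int.le_floor, ← Int.lt_add_one_iff, Int.floor_lt, le_div_iff₀ hε, div_lt_iff₀ hε]
      push_cast
      rfl
    simp only [Set.mem_inter_iff, Set.mem_preimage, Complex.reLm_coe, Complex.imLm_coe, ← key,
      Set.mem_ofPred_eq, Set.mem_Icc, Prod.le_def, cell]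
    tauto
  rw [this]
  exact ((convex_Ico _ _).linear_preimage _).inter ((convex_Ico _ _).linear_preimage _)

/-- Cells which do not meet the complement of `Ω`. -/
def goodCells (ε : ℝ) (Ω : Set ℂ) : Set (ℤ × ℤ) := {p | ∀ z, cell ε z = p → z ∈ Ω}

theorem goodCells_finite {ε : ℝ} (hε : 0 < ε) {Ω : Set ℂ} {R : ℝ} (hR : ∀ z ∈ Ω, ‖z‖ ≤ R) :
    ∃ M : ℤ, ∀ p ∈ goodCells ε Ω, |p.1| ≤ M ∧ |p.2| ≤ M := by
  obtain ⟨M, hM⟩ := exists_int_gt (R / ε)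
  refine ⟨M + 1, fun p hp => ?_⟩
  have h := hR _ (hp _ (cell_center hε p))
  have key : ∀ n : ℤ, |((n : ℝ) + 1 / 2) * ε| ≤ R → |n| ≤ M + 1 := by
    intro n hn
    rw [abs_mul, abs_of_pos hε, ← le_div_iff₀ hε, abs_le] at hn
    rw [abs_le]
    constructor
    · have : (-(M + 1) : ℝ) < n := by linarith
      have : -(M + 1) < n := by exact_mod_cast this
      omega
    · have : (n : ℝ) < M + 1 := by linarith
      have : n < M + 1 := by exact_mod_cast this
      omega
  exact ⟨key _ ((Complex.abs_re_le_norm _).trans h), key _ ((Complex.abs_im_le_norm _).trans h)⟩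

theorem goodCells_triv {ε : ℝ} (hε : 0 < ε) {Ω : Set ℂ} {R : ℝ} (hR : ∀ z ∈ Ω, ‖z‖ ≤ R)
    (hconn : IsPreconnected Ωᶜ) (p : ℤ × ℤ) (hp : p ∉ goodCells ε Ω) :
    GridTriv (goodCells ε Ω) p := by
  have hbad : ∀ z ∈ Ωᶜ, cell ε z ∉ goodCells ε Ω := fun z hz h => hz (h z rfl)
  obtain ⟨M, hM⟩ := goodCells_finite hε hR
  -- a far away point
  have hfar : cellCenter ε (0, M) ∈ Ωᶜ ∨ ∃ z ∈ Ωᶜ, M ≤ (cell ε z).2 := by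
    right
    refine ⟨cellCenter ε (0, M + |⌈R / ε⌉| + |M|), fun h => ?_, ?_⟩
    · have h1 := (Complex.abs_im_le_norm _).trans (hR _ h)
      simp only [cellCenter] at h1
      have h2 := (le_abs_self _).trans h1
      rw [← le_div_iff₀ hε] at h2
      have h3 := Int.le_ceil (R / ε)
      have h4 : (⌈R / ε⌉ : ℝ) ≤ (M + |⌈R / ε⌉| + |M| : ℤ) := by
        exact_mod_cast (by have := le_abs_self ⌈R / ε⌉; have := neg_abs_le M; omega)
      linarith
    · rw [cell_center hε]
      have := abs_nonneg ⌈R / ε⌉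
      have := abs_nonneg M
      simp only
      omega
  obtain ⟨z₀, hz₀, hz₀M⟩ : ∃ z ∈ Ωᶜ, M ≤ (cell ε z).2 := by
    rcases hfar with h | h
    · exact ⟨_, h, by rw [cell_center hε]⟩
    · exact h
  have h0 : GridTriv (goodCells ε Ω) (cell ε z₀) := by
    refine ⟨fun _ => 0, fun a ha b hb _ => ?_⟩
    have := (abs_le.1 (hM a ha).2).2
    unfold gridCross
    rw [if_neg (by omega), if_neg (by omega)]
    rfl
  obtain ⟨z, hz⟩ : ∃ z, cell ε z = p ∧ z ∉ Ω := by
    simpa [goodCells] using hp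
  obtain ⟨rfl, hz⟩ := hz
  have step : ∀ z ∈ Ωᶜ, ∀ w ∈ Ωᶜ, ‖z - w‖ < ε → GridTriv (goodCells ε Ω) (cell ε z) →
      GridTriv (goodCells ε Ω) (cell ε w) := fun z hz w hw h =>
    gridTriv_of_near (hbad z hz) (hbad w hw) (cell_near hε h).1 (cell_near hε h).2
  by_contra hcon
  let U : Set ℂ := ⋃ w ∈ {w | w ∈ Ωᶜ ∧ GridTriv (goodCells ε Ω) (cell ε w)}, Metric.ball w (ε / 2)
  let V : Set ℂ := ⋃ w ∈ {w | w ∈ Ωᶜ ∧ ¬ GridTriv (goodCells ε Ω) (cell ε w)}, Metric.ball w (ε / 2)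
  have hU : IsOpen U := isOpen_biUnion fun _ _ => Metric.isOpen_ball
  have hV : IsOpen V := isOpen_biUnion fun _ _ => Metric.isOpen_ball
  obtain ⟨u, hu, huU, huV⟩ := hconn U V hU hV
    (by
      intro w hw
      by_cases h : GridTriv (goodCells ε Ω) (cell ε w)
      · left; exact Set.mem_biUnion (x := w) ⟨hw, h⟩ (Metric.mem_ball_self (by linarith))
      · right; exact Set.mem_biUnion (x := w) ⟨hw, h⟩ (Metric.mem_ball_self (by linarith)))
    ⟨z₀, hz₀, Set.mem_biUnion (x := z₀) ⟨hz₀, h0⟩ (Metric.mem_ball_self (by linarith))⟩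
    ⟨z, hz, Set.mem_biUnion (x := z) ⟨hz, hcon⟩ (Metric.mem_ball_self (by linarith))⟩
  obtain ⟨a, ⟨ha, ha'⟩, hau⟩ := Set.mem_iUnion₂.1 huU
  obtain ⟨b, ⟨hb, hb'⟩, hbu⟩ := Set.mem_iUnion₂.1 huV
  refine hb' (step a ha b hb ?_ ha')
  rw [← dist_eq_norm]
  have := dist_triangle a u b
  rw [Metric.mem_ball] at hau hbu
  rw [dist_comm] at hau
  linarith

/-- Points close to `z`, coordinatewise, are good. -/
theorem mem_ball_of_cell {ε : ℝ} (hε : 0 < ε) {z z' w : ℂ} (h : ‖z' - z‖ < ε)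
    (h1 : (cell ε w).1 = (cell ε z).1 ∨ (cell ε w).1 = (cell ε z').1)
    (h2 : (cell ε w).2 = (cell ε z).2 ∨ (cell ε w).2 = (cell ε z').2) :
    w ∈ Metric.ball z (4 * ε) := by
  have key : ∀ a b c : ℝ, |b - a| < ε → (⌊c / ε⌋ = ⌊a / ε⌋ ∨ ⌊c / ε⌋ = ⌊b / ε⌋) →
      |c - a| < 2 * ε := by
    have key0 : ∀ a c : ℝ, ⌊c / ε⌋ = ⌊a / ε⌋ → |c - a| < ε := by
      intro a c h
      have := Int.abs_sub_lt_one_of_floor_eq_floor h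
      rwa [← sub_div, abs_div, abs_of_pos hε, div_lt_one hε] at this
    intro a b c hab h
    rcases h with h | h
    · have := key0 _ _ h; linarith
    · have := key0 _ _ h
      have := abs_sub_le c b a
      linarith
  have e1 := key z.re z'.re w.re
    (lt_of_le_of_lt (by simpa using Complex.abs_re_le_norm (z' - z)) h) h1
  have e2 := key z.im z'.im w.im
    (lt_of_le_of_lt (by simpa using Complex.abs_im_le_norm (z' - z)) h) h2
  rw [Metric.mem_ball, dist_eq_norm]
  have := Complex.norm_le_abs_re_add_abs_im (w - z)
  simp only [Complex.sub_re, Complex.sub_im] at this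
  linarith

theorem main_aux {Ω : Set ℂ} [PathConnectedSpace Ω] {R : ℝ} (hR : ∀ z ∈ Ω, ‖z‖ ≤ R)
    (hconn : IsPreconnected Ωᶜ) (hΩ : IsOpen Ω) (x : Ω) (γ : Path x x) :
    γ.Homotopic (Path.refl x) := by
  classical
  -- choice of the mesh
  obtain ⟨ε, hε, hball⟩ : ∃ ε > 0, ∀ t, Metric.ball (γ t : ℂ) (4 * ε) ⊆ Ω := by
    have hK : IsCompact (Set.range fun t => (γ t : ℂ)) := isCompact_range (by fun_prop)
    obtain ⟨δ, hδ, h⟩ := hK.exists_thickening_subset_open hΩ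
      (by rintro _ ⟨t, rfl⟩; exact (γ t).2)
    refine ⟨δ / 4, by linarith, fun t w hw => h ?_⟩
    rw [Metric.mem_thickening_iff]
    refine ⟨_, ⟨t, rfl⟩, ?_⟩
    rw [Metric.mem_ball] at hw
    linarith
  -- centres of cells as points of `Ω`
  let c : ℤ × ℤ → Ω := fun p =>
    if h : p ∈ goodCells ε Ω then ⟨cellCenter ε p, h _ (cell_center hε p)⟩ else x
  have hc : ∀ p ∈ goodCells ε Ω, (c p : ℂ) = cellCenter ε p := by
    intro p hp; simp only [c, dif_pos hp]
  have hcell : ∀ p ∈ goodCells ε Ω, cell ε (c p) = p := by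
    intro p hp; rw [hc p hp, cell_center hε]
  have hfin : (goodCells ε Ω).Finite := by
    obtain ⟨M, hM⟩ := goodCells_finite hε hR
    refine (Set.finite_Icc (-M, -M) (M, M)).subset fun p hp => ?_
    have h1 := abs_le.1 (hM p hp).1
    have h2 := abs_le.1 (hM p hp).2
    exact ⟨⟨h1.1, h2.1⟩, ⟨h1.2, h2.2⟩⟩
  obtain ⟨t, ht⟩ : ∃ t : ∀ a, FundamentalGroupoid.mk (c a) ⟶ FundamentalGroupoid.mk x,
      ∀ a ∈ goodCells ε Ω, ∀ b ∈ goodCells ε Ω, GridAdj a b →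
        segClass (c a) (c b) ≫ t b = t a := by
    have := grid_potential (FundamentalGroupoid.mk x)
      (fun Y => ⟨Path.Homotopic.Quotient.mk (PathConnectedSpace.somePath Y.as x)⟩)
      (fun p => FundamentalGroupoid.mk (c p)) (fun a b => segClass (c a) (c b)) _
      hfin.toFinset rfl
    simp only [Set.Finite.mem_toFinset, Set.Finite.coe_toFinset] at this
    refine this ?_ ?_ ?_
    · intro a ha b hb hab
      have hsub : {z | cell ε z ∈ Set.Icc (a ⊓ b) (a ⊔ b)} ⊆ Ω := by
        intro z hz
        have : cell ε z = a ∨ cell ε z = b := by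
          replace hz : cell ε z ∈ Set.Icc _ _ := hz
          generalize cell ε z = q at hz
          obtain ⟨a1, a2⟩ := a
          obtain ⟨b1, b2⟩ := b
          obtain ⟨q1, q2⟩ := q
          simp only [GridAdj, Set.mem_ofPred_eq, Set.mem_Icc, Prod.le_def, Prod.mk_inf_mk,
            Prod.mk_sup_mk, Prod.mk.injEq] at hab hz ⊢
          omega
        rcases this with h | h
        · exact ha z h
        · exact hb z h
      rw [segClass_comp (convex_cells hε (a ⊓ b) (a ⊔ b)) hsub, segClass_self]
      · simp [hcell a ha]
      · simp [hcell b hb]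
      · simp [hcell a ha]
    · intro x' y' h1 h2 h3 h4
      have hsub : {z | cell ε z ∈ Set.Icc (x' - 1, y' - 1) (x', y')} ⊆ Ω := by
        intro z hz
        have : cell ε z = (x', y') ∨ cell ε z = (x' - 1, y') ∨ cell ε z = (x', y' - 1) ∨
            cell ε z = (x' - 1, y' - 1) := by
          replace hz : cell ε z ∈ Set.Icc _ _ := hz
          generalize cell ε z = q at hz
          obtain ⟨q1, q2⟩ := q
          simp only [Set.mem_ofPred_eq, Set.mem_Icc, Prod.le_def, Prod.mk.injEq] at hz ⊢
          omega
        rcases this with h | h | h | h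
        · exact h1 z h
        · exact h2 z h
        · exact h3 z h
        · exact h4 z h
      rw [segClass_comp (convex_cells hε _ _) hsub, segClass_comp (convex_cells hε _ _) hsub]
      · simp [hcell _ h1]
      · simp [hcell _ h3]
      · simp [hcell _ h4]
      · simp [hcell _ h1]
      · simp [hcell _ h2]
      · simp [hcell _ h4]
    · exact fun p hp => goodCells_triv hε hR hconn p hp
  -- extended potential
  have ht' : ∀ a ∈ goodCells ε Ω, ∀ b ∈ goodCells ε Ω, (a = b ∨ GridAdj a b) →
        segClass (c a) (c b) ≫ t b = t a := by
    rintro a ha b hb (rfl | h)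
    · rw [segClass_self, Category.id_comp]
    · exact ht a ha b hb h
  let T : ∀ z : Ω, FundamentalGroupoid.mk z ⟶ FundamentalGroupoid.mk x := fun z =>
    segClass z (c (cell ε z)) ≫ t (cell ε z)
  have hloc : ∀ (z z' : Ω) (σ : Path z z'), (∀ s, ‖(σ s : ℂ) - z‖ < ε) →
      Metric.ball (z : ℂ) (4 * ε) ⊆ Ω →
      FundamentalGroupoid.fromPath (Path.Homotopic.Quotient.mk σ) ≫ T z' = T z := by
    intro z z' σ hσ hB
    have hzz : ‖(z' : ℂ) - z‖ < ε := by simpa using hσ 1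
    have hnear := cell_near hε hzz
    obtain ⟨p, hp⟩ : ∃ p, p = cell ε z := ⟨_, rfl⟩
    obtain ⟨p', hp'⟩ : ∃ p', p' = cell ε z' := ⟨_, rfl⟩
    have hC := convex_ball (z : ℂ) (4 * ε)
    have good : ∀ q : ℤ × ℤ, (q.1 = p.1 ∨ q.1 = p'.1) → (q.2 = p.2 ∨ q.2 = p'.2) →
        q ∈ goodCells ε Ω ∧ (c q : ℂ) ∈ Metric.ball (z : ℂ) (4 * ε) := by
      intro q h1 h2
      have hq : q ∈ goodCells ε Ω := by
        rintro w rfl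
        subst hp hp'
        exact hB (mem_ball_of_cell hε hzz h1 h2)
      refine ⟨hq, mem_ball_of_cell hε hzz ?_ ?_⟩
      · rw [hcell q hq, ← hp, ← hp']; exact h1
      · rw [hcell q hq, ← hp, ← hp']; exact h2
    obtain ⟨gp, bp⟩ := good p (Or.inl rfl) (Or.inl rfl)
    obtain ⟨gp', bp'⟩ := good p' (Or.inr rfl) (Or.inr rfl)
    obtain ⟨gq, bq⟩ := good (p.1, p'.2) (Or.inl rfl) (Or.inr rfl)
    have bz : (z : ℂ) ∈ Metric.ball (z : ℂ) (4 * ε) := Metric.mem_ball_self (by linarith)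
    have bσ : ∀ s, (σ s : ℂ) ∈ Metric.ball (z : ℂ) (4 * ε) := by
      intro s
      rw [Metric.mem_ball, dist_eq_norm]
      have := hσ s
      linarith
    have bz' : (z' : ℂ) ∈ Metric.ball (z : ℂ) (4 * ε) := by simpa using bσ 1
    rw [← hp, ← hp', abs_le, abs_le] at hnear
    have e1 : segClass (c p) (c (p.1, p'.2)) ≫ t (p.1, p'.2) = t p := by
      refine ht' _ gp _ gq ?_
      rcases (by omega : p.2 = p'.2 ∨ (p.2 = p'.2 + 1 ∨ p'.2 = p.2 + 1)) with h | h
      · exact Or.inl (Prod.ext rfl h)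
      · exact Or.inr (Or.inl ⟨rfl, h⟩)
    have e2 : segClass (c (p.1, p'.2)) (c p') ≫ t p' = t (p.1, p'.2) := by
      refine ht' _ gq _ gp' ?_
      rcases (by omega : p.1 = p'.1 ∨ (p.1 = p'.1 + 1 ∨ p'.1 = p.1 + 1)) with h | h
      · exact Or.inl (Prod.ext h rfl)
      · exact Or.inr (Or.inr ⟨rfl, h⟩)
    have e3 : FundamentalGroupoid.fromPath (Path.Homotopic.Quotient.mk σ) = segClass z z' :=
      mk_eq_segClass hC hB σ bσ
    simp only [T]
    rw [← hp, ← hp', e3, ← e1, ← e2, ← Category.assoc, segClass_comp hC hB bz bz' bp',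
      ← Category.assoc, ← Category.assoc, segClass_comp hC hB bz bp bq,
      segClass_comp hC hB bz bq bp']
  have hlc : IsLocallyConstant (fun s : unitInterval =>
      (FundamentalGroupoid.fromPath (Path.Homotopic.Quotient.mk (γ.subpath 0 s)) ≫ T (γ s)
        = T (γ 0))) := by
    rw [IsLocallyConstant.iff_eventually_eq]
    intro s
    have hcont : ContinuousAt (fun s => (γ s : ℂ)) s := by fun_prop
    obtain ⟨η, hη, hηs⟩ := Metric.continuousAt_iff.1 hcont ε hε
    filter_upwards [Metric.ball_mem_nhds s hη] with r hr
    have hsr := hloc (γ s) (γ r) (γ.subpath s r) (by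
      intro u
      obtain ⟨v, hv, hv'⟩ : (γ.subpath s r) u ∈ γ '' Set.uIcc s r := by
        rw [← Path.range_subpath]; exact Set.mem_range_self u
      rw [← hv', ← dist_eq_norm]
      refine hηs (lt_of_le_of_lt ?_ hr)
      have hv2 : (v : ℝ) ∈ Set.uIcc (s : ℝ) r := by
        rw [Set.mem_uIcc] at hv ⊢
        exact hv
      rw [Subtype.dist_eq, Subtype.dist_eq, Real.dist_eq, Real.dist_eq]
      rw [abs_sub_comm, abs_sub_comm (r : ℝ)]
      rw [Set.mem_uIcc] at hv2
      rcases hv2 with h | h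
      · rw [abs_of_nonpos (by linarith), abs_of_nonpos (by linarith)]; linarith
      · rw [abs_of_nonneg (by linarith), abs_of_nonneg (by linarith)]; linarith) (hball s)
    have htrans : FundamentalGroupoid.fromPath (Path.Homotopic.Quotient.mk (γ.subpath 0 r)) =
        FundamentalGroupoid.fromPath (Path.Homotopic.Quotient.mk (γ.subpath 0 s)) ≫
        FundamentalGroupoid.fromPath (Path.Homotopic.Quotient.mk (γ.subpath s r)) :=
      Quotient.sound ⟨(Path.Homotopy.subpathTransSubpath γ 0 s r).symm⟩
    rw [htrans, Category.assoc, hsr]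
  have h01 := hlc.apply_eq_of_preconnectedSpace 0 1
  have h0 : FundamentalGroupoid.fromPath (Path.Homotopic.Quotient.mk (γ.subpath 0 0)) ≫ T (γ 0)
        = T (γ 0) := by
    rw [Path.subpath_self]
    exact Category.id_comp _
  have h1 := h01.mp h0
  rw [Path.subpath_zero_one] at h1
  have hcast : ∀ (a b : Ω) (ha : a = x) (hb : b = x),
      FundamentalGroupoid.fromPath (Path.Homotopic.Quotient.mk (γ.cast ha hb)) ≫ T b = T a →
      FundamentalGroupoid.fromPath (Path.Homotopic.Quotient.mk γ) ≫ T x = T x := by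
    rintro a b rfl rfl h
    exact h
  have h2 := hcast _ _ _ _ h1
  have h3 : FundamentalGroupoid.fromPath (Path.Homotopic.Quotient.mk γ) = 𝟙 _ := by
    rw [← cancel_mono (T x), h2, Category.id_comp]
  exact Quotient.exact h3

theorem regular_open_with_connected_complement_is_simply_connected
    (Ω : Set ℂ) (hΩbdd : Bornology.IsBounded Ω) (hΩconn : IsConnected Ω)
    (hΩopen : IsOpen Ω) (hreg : Ω = interior (closure Ω))
    (hcomp : IsConnected (closure Ω)ᶜ) :
    SimplyConnectedSpace Ω := by
  have hpc : PathConnectedSpace Ω :=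
    isPathConnected_iff_pathConnectedSpace.1 (hΩopen.isConnected_iff_isPathConnected.1 hΩconn)
  have hconn : IsPreconnected Ωᶜ := by
    have h : Ωᶜ = closure (closure Ω)ᶜ := by
      rw [closure_compl, ← hreg]
    rw [h]
    exact hcomp.isPreconnected.closure
  obtain ⟨R, hR⟩ := hΩbdd.exists_norm_le
  rw [simply_connected_iff_loops_nullhomotopic]
  exact ⟨hpc, fun x γ => main_aux hR hconn hΩopen x γ⟩
end
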